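/- Let G be a group, P a finite G-poset which is an extension of a G-stable subposet Q by minimal elements, and let M = P \ Q. Then for n >= 1 the direct sum over m in M of H~_{n-1}(P_{>m}) carries the structure of an induced ZG-module: it is isomorphic as a ZG-module to the direct sum over a set of representatives m of the G-orbits on M of the induced modules Ind_{G_m}^G H~_{n-1}(P_{>m}), where G_m denotes the stabiliser of m in G. Moreover the map mu(sum_m [z_m]) = sum_m [m * z_m - 0hat * z_m] from this direct sum to H~_n(wedge_{m in M} Sigma P_{>m}) is an isomorphism of ZG-modules. -/

import Mathlib

/-! Ordered chains, the augmented simplicial chain complex of the order complex of a poset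
(given by an arbitrary strict-order relation), reduced homology, and induced maps. -/

/-- Ordered chains with `n` vertices with respect to a relation `r`
(the `(n-1)`-simplices of the order complex). -/
def OCh (α : Type*) (r : α → α → Prop) (n : ℕ) : Type _ :=
  {f : Fin n → α // ∀ ⦃i j : Fin n⦄, i < j → r (f i) (f j)}

/-- The augmented simplicial chain group with `n`-vertex chains as basis
(`n = 0` gives the augmentation degree `-1`). -/
abbrev ACh (α : Type*) (r : α → α → Prop) (n : ℕ) := OCh α r n →₀ ℤ

/-- The `i`-th face of an `(n+1)`-vertex ordered chain. -/
def OCh.face {α : Type*} {r : α → α → Prop} {n : ℕ} (c : OCh α r (n + 1)) (i : Fin (n + 1)) :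
    OCh α r n :=
  ⟨c.1 ∘ i.succAbove, fun _ _ h => c.2 (Fin.strictMono_succAbove i h)⟩

/-- The simplicial boundary map of the augmented chain complex. -/
noncomputable def bdry (α : Type*) (r : α → α → Prop) (n : ℕ) :
    ACh α r (n + 1) →ₗ[ℤ] ACh α r n :=
  Finsupp.lsum ℤ fun c => LinearMap.toSpanSingleton ℤ _
    (∑ i : Fin (n + 1), ((-1 : ℤ) ^ (i : ℕ)) • Finsupp.single (c.face i) (1 : ℤ))

/-- Augmented `n`-cycles (chains with `n+1` vertices). -/
noncomputable def cyc (α : Type*) (r : α → α → Prop) (n : ℕ) :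
    Submodule ℤ (ACh α r (n + 1)) := LinearMap.ker (bdry α r n)

/-- Augmented `n`-boundaries (chains with `n+1` vertices). -/
noncomputable def bdries (α : Type*) (r : α → α → Prop) (n : ℕ) :
    Submodule ℤ (ACh α r (n + 1)) := LinearMap.range (bdry α r (n + 1))

/-- Reduced simplicial homology `H̃ₙ` (over `ℤ`) of the order complex of `(α, r)`. -/
noncomputable abbrev redH (α : Type*) (r : α → α → Prop) (n : ℕ) :=
  cyc α r n ⧸ (bdries α r n).comap (cyc α r n).subtype

/-- Reduced homology in degree `-1`. -/
noncomputable abbrev redHneg (α : Type*) (r : α → α → Prop) :=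
  (⊤ : Submodule ℤ (ACh α r 0)) ⧸
    (LinearMap.range (bdry α r 0)).comap (⊤ : Submodule ℤ (ACh α r 0)).subtype

section maps

variable {α β : Type*} {rα : α → α → Prop} {rβ : β → β → Prop}

/-- The simplicial map on ordered chains induced by a relation-preserving map. -/
def cmap (f : α → β) (hf : ∀ ⦃a b⦄, rα a b → rβ (f a) (f b)) {n : ℕ} (c : OCh α rα n) :
    OCh β rβ n :=
  ⟨f ∘ c.1, fun _ _ h => hf (c.2 h)⟩

/-- The induced map on augmented chain groups. -/
noncomputable def cmapL (f : α → β) (hf : ∀ ⦃a b⦄, rα a b → rβ (f a) (f b)) (n : ℕ) :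
    ACh α rα n →ₗ[ℤ] ACh β rβ n :=
  Finsupp.lmapDomain ℤ ℤ (cmap f hf)

theorem bdry_single {n : ℕ} (c : OCh α rα (n + 1)) (b : ℤ) :
    bdry α rα n (Finsupp.single c b) =
      b • ∑ i : Fin (n + 1), ((-1 : ℤ) ^ (i : ℕ)) • Finsupp.single (c.face i) (1 : ℤ) := by
  simp [bdry, Finsupp.lsum_single, LinearMap.toSpanSingleton_apply]

theorem face_cmap (f : α → β) (hf : ∀ ⦃a b⦄, rα a b → rβ (f a) (f b)) {n : ℕ}
    (c : OCh α rα (n + 1)) (i : Fin (n + 1)) :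
    (cmap f hf c).face i = cmap f hf (c.face i) := rfl

/-- Naturality of the boundary map. -/
theorem bdry_cmapL (f : α → β) (hf : ∀ ⦃a b⦄, rα a b → rβ (f a) (f b)) (n : ℕ) :
    (bdry β rβ n).comp (cmapL f hf (n + 1)) = (cmapL f hf n).comp (bdry α rα n) := by
  refine Finsupp.lhom_ext fun c b => ?_
  simp only [LinearMap.comp_apply, cmapL, Finsupp.lmapDomain_apply, Finsupp.mapDomain_single,
    bdry_single]
  rw [← Finsupp.lmapDomain_apply ℤ ℤ (cmap f hf), map_smul, map_sum]
  simp [Finsupp.lmapDomain_apply, Finsupp.mapDomain_single, face_cmap]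

theorem cmapL_mem_cyc (f : α → β) (hf : ∀ ⦃a b⦄, rα a b → rβ (f a) (f b)) {n : ℕ}
    {z : ACh α rα (n + 1)} (hz : z ∈ cyc α rα n) :
    cmapL f hf (n + 1) z ∈ cyc β rβ n := by
  have := congrArg (fun φ : ACh α rα (n+1) →ₗ[ℤ] ACh β rβ n => φ z) (bdry_cmapL f hf n)
  simp only [LinearMap.comp_apply] at this
  simp only [cyc, LinearMap.mem_ker] at hz ⊢
  rw [this, hz, map_zero]

/-- The induced map on reduced homology of a relation-preserving map. -/
noncomputable def indH (f : α → β) (hf : ∀ ⦃a b⦄, rα a b → rβ (f a) (f b)) (n : ℕ) :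
    redH α rα n →ₗ[ℤ] redH β rβ n :=
  Submodule.mapQ _ _
    ((cmapL f hf (n + 1)).restrict (fun _ hz => cmapL_mem_cyc f hf hz))
    (by
      rintro ⟨z, hz⟩ hmem
      simp only [Submodule.mem_comap, bdries, LinearMap.mem_range] at hmem ⊢
      obtain ⟨w, hw⟩ := hmem
      refine ⟨cmapL f hf (n + 2) w, ?_⟩
      have := congrArg (fun φ : ACh α rα (n+2) →ₗ[ℤ] ACh β rβ (n+1) => φ w) (bdry_cmapL f hf (n+1))
      simp only [LinearMap.comp_apply] at this
      simp only [LinearMap.restrict_apply]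
      rw [this, hw]
      rfl)

/-- The induced map on reduced homology in degree `-1`. -/
noncomputable def indHneg (f : α → β) (hf : ∀ ⦃a b⦄, rα a b → rβ (f a) (f b)) :
    redHneg α rα →ₗ[ℤ] redHneg β rβ :=
  Submodule.mapQ _ _ ((cmapL f hf 0).restrict (fun _ _ => Submodule.mem_top))
    (by
      rintro ⟨z, hz⟩ hmem
      simp only [Submodule.mem_comap, LinearMap.mem_range] at hmem ⊢
      obtain ⟨w, hw⟩ := hmem
      refine ⟨cmapL f hf 1 w, ?_⟩
      have := congrArg (fun φ : ACh α rα 1 →ₗ[ℤ] ACh β rβ 0 => φ w) (bdry_cmapL f hf 0)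
      simp only [LinearMap.comp_apply] at this
      simp only [LinearMap.restrict_apply]
      rw [this, hw]
      rfl)

/-- Coning off chains with a new bottom vertex `b`. -/
def coneMap (f : α → β) (hf : ∀ ⦃a b⦄, rα a b → rβ (f a) (f b)) (b : β)
    (hb : ∀ a : α, rβ b (f a)) {n : ℕ} (c : OCh α rα n) : OCh β rβ (n + 1) :=
  ⟨Fin.cons b (f ∘ c.1), by
    intro i j hij
    rcases Fin.eq_zero_or_eq_succ j with hj | ⟨j', rfl⟩
    · subst hj; exact absurd hij (Fin.not_lt_zero i)
    · rcases Fin.eq_zero_or_eq_succ i with hi | ⟨i', rfl⟩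
      · subst hi; simpa using hb (c.1 j')
      · have h' : i' < j' := by simpa using hij
        simpa using hf (c.2 h')⟩

/-- The linear extension of `coneMap` to chain groups: `z ↦ b * z`. -/
noncomputable def coneL (f : α → β) (hf : ∀ ⦃a b⦄, rα a b → rβ (f a) (f b)) (b : β)
    (hb : ∀ a : α, rβ b (f a)) (n : ℕ) : ACh α rα n →ₗ[ℤ] ACh β rβ (n + 1) :=
  Finsupp.lmapDomain ℤ ℤ (coneMap f hf b hb)

end maps

section PosetConstructions

/-- The strict order of the poset `P_Q` on `Option P`, where `none` plays the role of the
adjoined minimal element `0̂_Q` lying below exactly the elements of `Q`. -/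
def extRel {P : Type*} (rP : P → P → Prop) (Q : Set P) : Option P → Option P → Prop
  | some x, some y => rP x y
  | none, some y => y ∈ Q
  | _, none => False

/-- The strict order of the poset suspension `Σ R` on `Bool ⊕ R`; `Sum.inl false` and
`Sum.inl true` are the two adjoined elements `0̂_R` and `0̂'_R`, lying below every element
of `R` and incomparable with each other. -/
def suspRel {R : Type*} (rR : R → R → Prop) : Bool ⊕ R → Bool ⊕ R → Prop
  | Sum.inl _, Sum.inr _ => True
  | Sum.inr a, Sum.inr b => rR a b
  | _, _ => False

/-- The underlying set of the wedge of suspensions `⋁_{t ∈ T} Σ Rₜ`: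
`none` is the adjoined minimal element `0̂`, `some (Sum.inl t)` is the element `t ∈ T`, and
`some (Sum.inr ⟨t, x⟩)` is the element `(x, t) ∈ Rₜ × {t}`. -/
abbrev WedgeP (T : Type*) (R : T → Type*) := Option (T ⊕ Σ t, R t)

/-- The strict order of the wedge of suspensions of the posets `Rₜ`. -/
def wRel {T : Type*} {R : T → Type*} (r : ∀ t, R t → R t → Prop) :
    WedgeP T R → WedgeP T R → Prop
  | none, some (Sum.inr _) => True
  | some (Sum.inl t), some (Sum.inr b) => t = b.1
  | some (Sum.inr a), some (Sum.inr b) => ∃ h : a.1 = b.1, r b.1 (h ▸ a.2) b.2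
  | _, _ => False

/-- The order complex of `(α, r)` restricted to the vertex set `S`: the abstract simplicial
complex whose simplices are the finite chains contained in `S`. -/
def cpx (α : Type*) (r : α → α → Prop) (S : Set α) : Set (Finset α) :=
  {s | ↑s ⊆ S ∧ ∀ a ∈ s, ∀ b ∈ s, a ≠ b → r a b ∨ r b a}

/-- The full order complex of `(α, r)`. -/
abbrev fullCpx (α : Type*) (r : α → α → Prop) : Set (Finset α) := cpx α r Set.univ

theorem empty_mem_cpx (α : Type*) (r : α → α → Prop) (S : Set α) : ∅ ∈ cpx α r S := by
  simp [cpx]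

/-- The length of the poset `(α, r)`: the supremum of the lengths of its chains. -/
noncomputable def posetLength (α : Type*) (r : α → α → Prop) : ℕ :=
  sSup {k : ℕ | Nonempty {f : Fin (k+1) → α // ∀ ⦃i j : Fin (k+1)⦄, i < j → r (f i) (f j)}}

theorem extRel_map_QQ {P : Type*} {rP : P → P → Prop} {Q : Set P} :
    ∀ ⦃a b : Option ↥Q⦄,
      extRel (fun x y : ↥Q => rP x y) Set.univ a b →
        extRel rP Q (Option.map Subtype.val a) (Option.map Subtype.val b) := by
  intro a b h
  match a, b with
  | none, some b => exact b.2
  | some a, some b => exact h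
  | none, none => exact h.elim
  | some _, none => exact h.elim

theorem extRel_optionMap {P : Type*} {rP : P → P → Prop} {Q : Set P} {f : P → P}
    (hf : ∀ ⦃a b⦄, rP a b → rP (f a) (f b)) (hfQ : ∀ ⦃q⦄, q ∈ Q → f q ∈ Q) :
    ∀ ⦃a b : Option P⦄, extRel rP Q a b → extRel rP Q (Option.map f a) (Option.map f b) := by
  intro a b h
  match a, b with
  | none, some b => exact hfQ h
  | some a, some b => exact hf h
  | none, none => exact h.elim
  | some _, none => exact h.elim

theorem suspRel_map {R : Type*} {rR : R → R → Prop} {f : R → R}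
    (hf : ∀ ⦃a b⦄, rR a b → rR (f a) (f b)) :
    ∀ ⦃a b : Bool ⊕ R⦄, suspRel rR a b → suspRel rR (Sum.map id f a) (Sum.map id f b) := by
  intro a b h
  match a, b with
  | Sum.inl x, Sum.inr b => trivial
  | Sum.inr a, Sum.inr b => exact hf h
  | Sum.inl x, Sum.inl y => exact h.elim
  | Sum.inr a, Sum.inl y => exact h.elim

theorem wRel_map {T : Type*} {R : T → Type*} {r : ∀ t, R t → R t → Prop}
    (fT : T → T) (fR : ∀ t, R t → R (fT t))
    (hf : ∀ (t : T) ⦃a b : R t⦄, r t a b → r (fT t) (fR t a) (fR t b)) :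
    ∀ ⦃a b : WedgeP T R⦄, wRel r a b →
      wRel r (Option.map (Sum.map fT (fun p => ⟨fT p.1, fR p.1 p.2⟩)) a)
        (Option.map (Sum.map fT (fun p => ⟨fT p.1, fR p.1 p.2⟩)) b) := by
  rintro (_ | (t | ⟨t, x⟩)) (_ | (t' | ⟨t', y⟩)) h <;> try exact h.elim
  · trivial
  · exact congrArg fT h
  · obtain ⟨ht, hr⟩ := h
    dsimp only at ht hr
    subst ht
    exact ⟨rfl, hf t hr⟩

end PosetConstructions

section IndModel

/-- A concrete model of the induced module `Ind_H^G N` (for `H` the subgroup of `G`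
given by the subset `stab`, acting on `N` via `ρ`): functions `f : G → N` satisfying
`f (g * h) = ρ h⁻¹ (f g)`. -/
noncomputable def IndSubG {G' : Type*} [Group G'] {N : Type*} [AddCommGroup N]
    (stab : Set G') (ρ : ∀ h : G', h ∈ stab → (N →+ N)) : AddSubgroup (G' → N) where
  carrier := {f | ∀ (g h : G') (hh : h ∈ stab) (hh' : h⁻¹ ∈ stab), f (g * h) = ρ h⁻¹ hh' (f g)}
  add_mem' := by
    intro f f' hf hf' g h hh hh'
    simp [hf g h hh hh', hf' g h hh hh']
  zero_mem' := by intro g h hh hh'; simp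
  neg_mem' := by
    intro f hf g h hh hh'
    simp [hf g h hh hh']

/-- Left translation action of `G` on the induced module model. -/
noncomputable def indTrans {G' : Type*} [Group G'] {N : Type*} [AddCommGroup N]
    (stab : Set G') (ρ : ∀ h : G', h ∈ stab → (N →+ N)) (g₀ : G') :
    ↥(IndSubG stab ρ) →+ ↥(IndSubG stab ρ) where
  toFun f := ⟨fun x => f.1 (g₀⁻¹ * x), by
    intro g h hh hh'
    simpa [mul_assoc] using f.2 (g₀⁻¹ * g) h hh hh'⟩
  map_zero' := Subtype.ext rfl
  map_add' _ _ := Subtype.ext rfl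

end IndModel

section ExtensionByMinimal

/-- `M = P \ Q`: the set of adjoined minimal elements. -/
def Mset {P : Type*} (Q : Set P) : Set P := {p | p ∉ Q}

/-- The subposet `P_{> m}` of elements strictly above `m`. -/
abbrev PgtT {P : Type*} [PartialOrder P] {Q : Set P} (m : ↥(Mset Q)) :=
  {x : P // (m : P) < x}

/-- The (strict) order of `P_{> m}`. -/
def rgt {P : Type*} [PartialOrder P] {Q : Set P} (m : ↥(Mset Q)) :
    PgtT m → PgtT m → Prop := fun a b => (a : P) < (b : P)

/-- The wedge of suspensions `⋁_{m ∈ M} Σ P_{>m}` (underlying set). -/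
abbrev WT (P : Type*) [PartialOrder P] (Q : Set P) :=
  WedgeP ↥(Mset Q) (fun m => PgtT m)

/-- The (strict) order of `⋁_{m ∈ M} Σ P_{>m}`. -/
def wrelT (P : Type*) [PartialOrder P] (Q : Set P) : WT P Q → WT P Q → Prop :=
  wRel (fun m => rgt m)

/-- The action of `g ∈ G` on `M = P \ Q`. -/
def gMe {P : Type*} {G : Type*} [Group G] [MulAction G P] {Q : Set P}
    (hQG : ∀ (g : G) (q : P), q ∈ Q → g • q ∈ Q) (g : G) (m : ↥(Mset Q)) : ↥(Mset Q) :=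
  ⟨g • (m : P), fun hq => m.2 (by simpa using hQG g⁻¹ _ hq)⟩

/-- The action of `g ∈ G` on the vertices of `⋁_{m ∈ M} Σ P_{>m}`
(`g • (p, m) = (g • p, g • m)`, `g • m = g • m`, `g • 0̂ = 0̂`). -/
def wVer {P : Type*} [PartialOrder P] {G : Type*} [Group G] [MulAction G P] {Q : Set P}
    (hsmul : ∀ (g : G) ⦃x y : P⦄, x < y → g • x < g • y)
    (hQG : ∀ (g : G) (q : P), q ∈ Q → g • q ∈ Q) (g : G) : WT P Q → WT P Q :=
  Option.map (Sum.map (gMe hQG g)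
    (fun p => ⟨gMe hQG g p.1, (⟨g • (p.2 : P), hsmul g p.2.2⟩ : PgtT (gMe hQG g p.1))⟩))

theorem wVer_mono {P : Type*} [PartialOrder P] {G : Type*} [Group G] [MulAction G P]
    {Q : Set P} (hsmul : ∀ (g : G) ⦃x y : P⦄, x < y → g • x < g • y)
    (hQG : ∀ (g : G) (q : P), q ∈ Q → g • q ∈ Q) (g : G) :
    ∀ ⦃a b : WT P Q⦄, wrelT P Q a b → wrelT P Q (wVer hsmul hQG g a) (wVer hsmul hQG g b) :=
  wRel_map (gMe hQG g)
    (fun (m : ↥(Mset Q)) (x : PgtT m) => (⟨g • (x : P), hsmul g x.2⟩ : PgtT (gMe hQG g m)))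
    (fun _ _ _ h => hsmul g h)

/-- The map from the fibre of the wedge at `g • m` to the fibre at `m` induced by `g⁻¹`
(on suspension vertex sets). -/
def fVer {P : Type*} [PartialOrder P] {G : Type*} [Group G] [MulAction G P] {Q : Set P}
    (hsmul : ∀ (g : G) ⦃x y : P⦄, x < y → g • x < g • y)
    (hQG : ∀ (g : G) (q : P), q ∈ Q → g • q ∈ Q) (g : G) (m : ↥(Mset Q)) :
    Bool ⊕ PgtT (gMe hQG g m) → Bool ⊕ PgtT m :=
  Sum.map id fun p => ⟨g⁻¹ • (p : P), by simpa [gMe] using hsmul g⁻¹ p.2⟩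

end ExtensionByMinimal

open scoped DirectSum

section SumAct

/-- The action of `g ∈ G` on `⊕_{m ∈ M} H̃ₖ(P_{>m})`, permuting the summands. -/
noncomputable def sumAct {P : Type*} [PartialOrder P] [DecidableEq P] {G : Type*} [Group G]
    [MulAction G P] {Q : Set P}
    (hsmul : ∀ (g : G) ⦃x y : P⦄, x < y → g • x < g • y)
    (hQG : ∀ (g : G) (q : P), q ∈ Q → g • q ∈ Q) (k : ℕ) (g : G) :
    (⨁ m : ↥(Mset Q), redH (PgtT m) (rgt m) k) →+
      ⨁ m : ↥(Mset Q), redH (PgtT m) (rgt m) k :=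
  DirectSum.toAddMonoid fun m =>
    ((DirectSum.of (fun m : ↥(Mset Q) => redH (PgtT m) (rgt m) k) (gMe hQG g m)).comp
      (indH (rα := rgt m) (rβ := rgt (gMe hQG g m))
        (fun x : PgtT m => (⟨g • (x : P), hsmul g x.2⟩ : PgtT (gMe hQG g m)))
        (fun _ _ h => hsmul g h) k).toAddMonoidHom)

/-- The stabiliser `G_m` of `m ∈ M` (as a subset of `G`). -/
def stabSet {P : Type*} {G : Type*} [Group G] [MulAction G P] (Q : Set P)
    (m : ↥(Mset Q)) : Set G := {h : G | h • (m : P) = (m : P)}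

/-- The action of the stabiliser `G_m` on `H̃ₖ(P_{>m})`. -/
noncomputable def stabρ {P : Type*} [PartialOrder P] {G : Type*} [Group G] [MulAction G P]
    {Q : Set P} (hsmul : ∀ (g : G) ⦃x y : P⦄, x < y → g • x < g • y)
    (m : ↥(Mset Q)) (k : ℕ) :
    ∀ h : G, h ∈ stabSet Q m →
      (redH (PgtT m) (rgt m) k →+ redH (PgtT m) (rgt m) k) :=
  fun h hh =>
    (indH (rα := rgt m) (rβ := rgt m)
      (fun x : PgtT m => (⟨h • (x : P),
        lt_of_le_of_lt (le_of_eq (show h • (m : P) = (m : P) from hh).symm)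
          (hsmul h x.2)⟩ : PgtT m))
      (fun _ _ hab => hsmul h hab) k).toAddMonoidHom

end SumAct

section ChainLevel

variable {α β γ : Type*} {rα : α → α → Prop} {rβ : β → β → Prop} {rγ : γ → γ → Prop}

theorem coneL_single (f : α → β) (hf : ∀ ⦃a b⦄, rα a b → rβ (f a) (f b)) (b : β)
    (hb : ∀ a : α, rβ b (f a)) {n : ℕ} (c : OCh α rα n) (a : ℤ) :
    coneL f hf b hb n (Finsupp.single c a) = Finsupp.single (coneMap f hf b hb c) a := by
  simp [coneL]

theorem cmapL_single (f : α → β) (hf : ∀ ⦃a b⦄, rα a b → rβ (f a) (f b)) {n : ℕ}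
    (c : OCh α rα n) (a : ℤ) :
    cmapL f hf n (Finsupp.single c a) = Finsupp.single (cmap f hf c) a := by
  simp [cmapL]

theorem face_zero_coneMap (f : α → β) (hf : ∀ ⦃a b⦄, rα a b → rβ (f a) (f b)) (b : β)
    (hb : ∀ a : α, rβ b (f a)) {n : ℕ} (c : OCh α rα n) :
    (coneMap f hf b hb c).face 0 = cmap f hf c := by
  apply Subtype.ext
  funext i
  simp [OCh.face, coneMap, cmap]

theorem face_succ_coneMap (f : α → β) (hf : ∀ ⦃a b⦄, rα a b → rβ (f a) (f b)) (b : β)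
    (hb : ∀ a : α, rβ b (f a)) {n : ℕ} (c : OCh α rα (n + 1)) (i : Fin (n + 1)) :
    (coneMap f hf b hb c).face i.succ = coneMap f hf b hb (c.face i) := by
  apply Subtype.ext
  funext j
  refine Fin.cases ?_ (fun j => ?_) j
  · simp [OCh.face, coneMap]
  · simp [OCh.face, coneMap, Fin.removeNth]

/-- The boundary of a cone: `∂(b * z) = z - b * ∂z`. -/
theorem bdry_coneL (f : α → β) (hf : ∀ ⦃a b⦄, rα a b → rβ (f a) (f b)) (b : β)
    (hb : ∀ a : α, rβ b (f a)) {n : ℕ} (z : ACh α rα (n + 1)) :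
    bdry β rβ (n + 1) (coneL f hf b hb (n + 1) z) =
      cmapL f hf (n + 1) z - coneL f hf b hb n (bdry α rα n z) := by
  induction z using Finsupp.induction_linear with
  | zero => simp
  | add x y hx hy => simp only [map_add, hx, hy]; abel
  | single c a =>
    rw [coneL_single, bdry_single, Fin.sum_univ_succ, bdry_single, cmapL_single, map_smul, map_sum,
      smul_add]
    simp only [face_zero_coneMap, face_succ_coneMap, map_smul, coneL_single]
    simp [pow_succ, sub_eq_add_neg]

theorem bdry_cmapL_apply (f : α → β) (hf : ∀ ⦃a b⦄, rα a b → rβ (f a) (f b)) (n : ℕ)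
    (z : ACh α rα (n + 1)) :
    bdry β rβ n (cmapL f hf (n + 1) z) = cmapL f hf n (bdry α rα n z) :=
  LinearMap.congr_fun (bdry_cmapL f hf n) z

theorem coneMap_injective (f : α → β) (hf : ∀ ⦃a b⦄, rα a b → rβ (f a) (f b)) (b : β)
    (hb : ∀ a : α, rβ b (f a)) (hinj : Function.Injective f) (n : ℕ) :
    Function.Injective (coneMap (n := n) f hf b hb) := by
  intro c d h
  apply Subtype.ext
  funext i
  have := congrFun (congrArg Subtype.val h) i.succ
  exact hinj (by simpa [coneMap] using this)

theorem cmap_injective (f : α → β) (hf : ∀ ⦃a b⦄, rα a b → rβ (f a) (f b))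
    (hinj : Function.Injective f) (n : ℕ) :
    Function.Injective (cmap (n := n) f hf) := by
  intro c d h
  apply Subtype.ext
  funext i
  exact hinj (congrFun (congrArg Subtype.val h) i)

theorem cmapL_comp (f : α → β) (hf : ∀ ⦃a b⦄, rα a b → rβ (f a) (f b)) (g : β → γ)
    (hg : ∀ ⦃a b⦄, rβ a b → rγ (g a) (g b)) (n : ℕ) (z : ACh α rα n) :
    cmapL g hg n (cmapL f hf n z) =
      cmapL (rα := rα) (rβ := rγ) (g ∘ f) (fun _ _ h => hg (hf h)) n z := by
  induction z using Finsupp.induction_linear with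
  | zero => simp
  | add x y hx hy => simp only [map_add, hx, hy]
  | single c a => simp only [cmapL_single]; rfl

theorem cmapL_id (n : ℕ) (z : ACh α rα n) :
    cmapL (rα := rα) (rβ := rα) id (fun _ _ h => h) n z = z := by
  induction z using Finsupp.induction_linear with
  | zero => simp
  | add x y hx hy => simp only [map_add, hx, hy]
  | single c a => rw [cmapL_single]; rfl

theorem cmapL_coneL {δ : Type*} {rδ : δ → δ → Prop}
    (f : α → β) (hf : ∀ ⦃a b⦄, rα a b → rβ (f a) (f b)) (b : β)
    (hb : ∀ a : α, rβ b (f a)) (g : β → δ) (hg : ∀ ⦃a b⦄, rβ a b → rδ (g a) (g b))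
    (f' : α → γ) (hf' : ∀ ⦃a b⦄, rα a b → rγ (f' a) (f' b))
    (g' : γ → δ) (hg' : ∀ ⦃a b⦄, rγ a b → rδ (g' a) (g' b))
    (d : δ) (hd : ∀ a, rδ d (g' a)) (hgb : g b = d) (hcomm : ∀ a, g (f a) = g' (f' a))
    (n : ℕ) (z : ACh α rα n) :
    cmapL g hg (n + 1) (coneL f hf b hb n z) = coneL g' hg' d hd n (cmapL f' hf' n z) := by
  subst hgb
  induction z using Finsupp.induction_linear with
  | zero => simp
  | add x y hx hy => simp only [map_add, hx, hy]
  | single c a =>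
    simp only [cmapL_single, coneL_single]
    congr 1
    apply Subtype.ext
    funext i
    refine Fin.cases ?_ (fun i => ?_) i
    · simp [cmap, coneMap]
    · simp [cmap, coneMap, hcomm]

/-- The map on reduced homology induced by a linear map of chain groups that preserves cycles
and boundaries. -/
noncomputable def redHMap {n n' : ℕ} (φ : ACh α rα (n + 1) →ₗ[ℤ] ACh β rβ (n' + 1))
    (hc : ∀ z ∈ cyc α rα n, φ z ∈ cyc β rβ n')
    (hb : ∀ z ∈ bdries α rα n, φ z ∈ bdries β rβ n') : redH α rα n →ₗ[ℤ] redH β rβ n' :=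
  Submodule.mapQ _ _ (φ.restrict hc) fun z hz => hb z.1 hz

theorem redH_mk_eq_mk {n : ℕ} {z w : cyc α rα n} :
    (Submodule.Quotient.mk z : redH α rα n) = Submodule.Quotient.mk w ↔
      (z : ACh α rα (n + 1)) - w ∈ bdries α rα n := by
  rw [Submodule.Quotient.eq]
  rfl

theorem indH_comp (f : α → β) (hf : ∀ ⦃a b⦄, rα a b → rβ (f a) (f b)) (g : β → γ)
    (hg : ∀ ⦃a b⦄, rβ a b → rγ (g a) (g b)) (n : ℕ) (x : redH α rα n) :
    indH g hg n (indH f hf n x) =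
      indH (rα := rα) (rβ := rγ) (g ∘ f) (fun _ _ h => hg (hf h)) n x := by
  induction x using Submodule.Quotient.induction_on with
  | H z => exact congrArg Submodule.Quotient.mk (Subtype.ext (cmapL_comp f hf g hg (n + 1) z.1))

theorem indH_id (n : ℕ) (x : redH α rα n) :
    indH (rα := rα) (rβ := rα) id (fun _ _ h => h) n x = x := by
  induction x using Submodule.Quotient.induction_on with
  | H z => exact congrArg Submodule.Quotient.mk (Subtype.ext (cmapL_id (n + 1) z.1))

theorem indH_congr {f f' : α → β} {hf : ∀ ⦃a b⦄, rα a b → rβ (f a) (f b)}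
    {hf' : ∀ ⦃a b⦄, rα a b → rβ (f' a) (f' b)} (h : f = f') (n : ℕ) (x : redH α rα n) :
    indH f hf n x = indH f' hf' n x := by
  subst h; rfl

end ChainLevel

section WedgeHomology

variable {T : Type*} {R : T → Type*} (r : ∀ t, R t → R t → Prop)

/-- The strict order of the disjoint union of the posets `Rₜ`. -/
def sigRel : (Σ t, R t) → (Σ t, R t) → Prop :=
  fun a b => ∃ h : a.1 = b.1, r b.1 (h ▸ a.2) b.2

variable {r} in
theorem wRel_inr_of_sigRel ⦃a b : Σ t, R t⦄ (h : sigRel r a b) :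
    wRel r (some (Sum.inr a)) (some (Sum.inr b)) := h

variable {r} in
theorem wRel_inr_mk (t : T) ⦃a b : R t⦄ (h : r t a b) :
    wRel r (some (Sum.inr ⟨t, a⟩)) (some (Sum.inr ⟨t, b⟩)) := ⟨rfl, h⟩

variable {r} in
theorem sigRel_mk (t : T) ⦃a b : R t⦄ (h : r t a b) : sigRel r ⟨t, a⟩ ⟨t, b⟩ := ⟨rfl, h⟩

theorem wRel_inl_inr_mk (t : T) (a : R t) :
    wRel r (some (Sum.inl t)) (some (Sum.inr ⟨t, a⟩)) := rfl

theorem wRel_none_inr (a : Σ t, R t) : wRel r none (some (Sum.inr a)) := trivial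

/-- The chain `t * z` in the wedge, for `z` a chain of `Rₜ`. -/
noncomputable def tipCone (t : T) (n : ℕ) :
    ACh (R t) (r t) n →ₗ[ℤ] ACh (WedgeP T R) (wRel r) (n + 1) :=
  coneL (fun x : R t => some (Sum.inr ⟨t, x⟩)) (wRel_inr_mk t) (some (Sum.inl t))
    (wRel_inl_inr_mk r t) n

/-- The chain `0̂ * z` in the wedge, for `z` a chain of `Rₜ`. -/
noncomputable def baseCone (t : T) (n : ℕ) :
    ACh (R t) (r t) n →ₗ[ℤ] ACh (WedgeP T R) (wRel r) (n + 1) :=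
  coneL (fun x : R t => some (Sum.inr ⟨t, x⟩)) (wRel_inr_mk t) none
    (fun x => wRel_none_inr r ⟨t, x⟩) n

/-- The chain `0̂ * z` in the wedge, for `z` a chain of the disjoint union of the `Rₜ`. -/
noncomputable def sigCone (n : ℕ) :
    ACh (Σ t, R t) (sigRel r) n →ₗ[ℤ] ACh (WedgeP T R) (wRel r) (n + 1) :=
  coneL (fun x => some (Sum.inr x)) wRel_inr_of_sigRel none (wRel_none_inr r) n

/-- The inclusion of the disjoint union of the `Rₜ` in the wedge, on chains. -/
noncomputable def sigIncl (n : ℕ) :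
    ACh (Σ t, R t) (sigRel r) n →ₗ[ℤ] ACh (WedgeP T R) (wRel r) n :=
  cmapL (fun x => some (Sum.inr x)) wRel_inr_of_sigRel n

/-- The inclusion of `Rₜ` in the disjoint union, on chains. -/
noncomputable def fibIncl (t : T) (n : ℕ) :
    ACh (R t) (r t) n →ₗ[ℤ] ACh (Σ t, R t) (sigRel r) n :=
  cmapL (fun x => ⟨t, x⟩) (sigRel_mk t) n

theorem injective_inr : Function.Injective fun x : Σ t, R t => (some (Sum.inr x) : WedgeP T R) :=
  (Option.some_injective _).comp Sum.inr_injective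

theorem injective_inr_fib (t : T) :
    Function.Injective fun x : R t => (some (Sum.inr ⟨t, x⟩) : WedgeP T R) :=
  injective_inr.comp sigma_mk_injective

/-- The coefficients of a chain of the wedge at the chains `t * c`. -/
noncomputable def tipPart (t : T) (n : ℕ) :
    ACh (WedgeP T R) (wRel r) (n + 1) →ₗ[ℤ] ACh (R t) (r t) n :=
  Finsupp.lcomapDomain _ (coneMap_injective _ (wRel_inr_mk t) _ (wRel_inl_inr_mk r t)
    (injective_inr_fib t) n)

/-- The coefficients of a chain of the wedge at the chains of the disjoint union of the `Rₜ`. -/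
noncomputable def sigPart (n : ℕ) :
    ACh (WedgeP T R) (wRel r) n →ₗ[ℤ] ACh (Σ t, R t) (sigRel r) n :=
  Finsupp.lcomapDomain _ (cmap_injective _ (wRel_inr_of_sigRel (r := r)) injective_inr n)

section comap

variable {A B : Type*} (f : A → B) (hf : Function.Injective f)

theorem lcomapDomain_single_apply (a : A) (x : ℤ) :
    Finsupp.lcomapDomain (R := ℤ) (M := ℤ) f hf (Finsupp.single (f a) x) = Finsupp.single a x :=
  Finsupp.comapDomain_single _ _ _ _

theorem lcomapDomain_single_of_ne (b : B) (hb : ∀ a, f a ≠ b) (x : ℤ) :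
    Finsupp.lcomapDomain (R := ℤ) (M := ℤ) f hf (Finsupp.single b x) = 0 := by
  ext a
  exact Finsupp.single_eq_of_ne (hb a)

end comap

theorem tipPart_tipCone (t : T) (n : ℕ) (z : ACh (R t) (r t) n) :
    tipPart r t n (tipCone r t n z) = z := by
  induction z using Finsupp.induction_linear with
  | zero => simp
  | add x y hx hy => simp only [map_add, hx, hy]
  | single c a => rw [tipCone, coneL_single]; exact lcomapDomain_single_apply _ _ _ _

theorem tipPart_tipCone_of_ne {t t' : T} (h : t ≠ t') (n : ℕ) (z : ACh (R t) (r t) n) :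
    tipPart r t' n (tipCone r t n z) = 0 := by
  induction z using Finsupp.induction_linear with
  | zero => simp
  | add x y hx hy => simp only [map_add, hx, hy, add_zero]
  | single c a =>
    rw [tipCone, coneL_single]
    refine lcomapDomain_single_of_ne _ _ _ (fun d hd => h ?_) _
    have := congrFun (congrArg Subtype.val hd) 0
    simpa [coneMap, eq_comm] using this

theorem tipPart_sigCone (t : T) (n : ℕ) (z : ACh (Σ t, R t) (sigRel r) n) :
    tipPart r t n (sigCone r n z) = 0 := by
  induction z using Finsupp.induction_linear with
  | zero => simp
  | add x y hx hy => simp only [map_add, hx, hy, add_zero]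
  | single c a =>
    rw [sigCone, coneL_single]
    refine lcomapDomain_single_of_ne _ _ _ (fun d hd => ?_) _
    have := congrFun (congrArg Subtype.val hd) 0
    simp [coneMap] at this

theorem tipPart_sigIncl (t : T) (n : ℕ) (z : ACh (Σ t, R t) (sigRel r) (n + 1)) :
    tipPart r t n (sigIncl r (n + 1) z) = 0 := by
  induction z using Finsupp.induction_linear with
  | zero => simp
  | add x y hx hy => simp only [map_add, hx, hy, add_zero]
  | single c a =>
    rw [sigIncl, cmapL_single]
    refine lcomapDomain_single_of_ne _ _ _ (fun d hd => ?_) _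
    have := congrFun (congrArg Subtype.val hd) 0
    simp [coneMap, cmap] at this

theorem sigPart_sigIncl (n : ℕ) (z : ACh (Σ t, R t) (sigRel r) n) :
    sigPart r n (sigIncl r n z) = z := by
  induction z using Finsupp.induction_linear with
  | zero => simp
  | add x y hx hy => simp only [map_add, hx, hy]
  | single c a => rw [sigIncl, cmapL_single]; exact lcomapDomain_single_apply _ _ _ _

theorem sigPart_sigCone (n : ℕ) (z : ACh (Σ t, R t) (sigRel r) n) :
    sigPart r (n + 1) (sigCone r n z) = 0 := by
  induction z using Finsupp.induction_linear with
  | zero => simp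
  | add x y hx hy => simp only [map_add, hx, hy, add_zero]
  | single c a =>
    rw [sigCone, coneL_single]
    refine lcomapDomain_single_of_ne _ _ _ (fun d hd => ?_) _
    have := congrFun (congrArg Subtype.val hd) 0
    simp [coneMap, cmap] at this

theorem sigPart_tipCone (t : T) (n : ℕ) (z : ACh (R t) (r t) n) :
    sigPart r (n + 1) (tipCone r t n z) = 0 := by
  induction z using Finsupp.induction_linear with
  | zero => simp
  | add x y hx hy => simp only [map_add, hx, hy, add_zero]
  | single c a =>
    rw [tipCone, coneL_single]
    refine lcomapDomain_single_of_ne _ _ _ (fun d hd => ?_) _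
    have := congrFun (congrArg Subtype.val hd) 0
    simp [coneMap, cmap] at this

theorem sigCone_fibIncl (t : T) (n : ℕ) (z : ACh (R t) (r t) n) :
    sigCone r n (fibIncl r t n z) = baseCone r t n z := by
  induction z using Finsupp.induction_linear with
  | zero => simp
  | add x y hx hy => simp only [map_add, hx, hy]
  | single c a =>
    rw [sigCone, fibIncl, baseCone, cmapL_single, coneL_single, coneL_single]
    rfl

theorem bdry_tipCone (t : T) (n : ℕ) (z : ACh (R t) (r t) (n + 1)) :
    bdry _ (wRel r) (n + 1) (tipCone r t (n + 1) z) =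
      sigIncl r (n + 1) (fibIncl r t (n + 1) z) - tipCone r t n (bdry _ _ n z) := by
  rw [tipCone, bdry_coneL, sigIncl, fibIncl, cmapL_comp]
  rfl

theorem bdry_sigCone (n : ℕ) (z : ACh (Σ t, R t) (sigRel r) (n + 1)) :
    bdry _ (wRel r) (n + 1) (sigCone r (n + 1) z) =
      sigIncl r (n + 1) z - sigCone r n (bdry _ _ n z) :=
  bdry_coneL _ _ _ _ _

theorem bdry_sigIncl (n : ℕ) (z : ACh (Σ t, R t) (sigRel r) (n + 1)) :
    bdry _ (wRel r) n (sigIncl r (n + 1) z) = sigIncl r n (bdry _ _ n z) :=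
  bdry_cmapL_apply _ _ _ _

theorem bdry_fibIncl (t : T) (n : ℕ) (z : ACh (R t) (r t) (n + 1)) :
    bdry _ (sigRel r) n (fibIncl r t (n + 1) z) = fibIncl r t n (bdry _ _ n z) :=
  bdry_cmapL_apply _ _ _ _

theorem wRel_right_inr {a b : WedgeP T R} (h : wRel r a b) : ∃ x, b = some (Sum.inr x) := by
  rcases a with _ | (t | a) <;> rcases b with _ | (t' | b) <;> first | exact h.elim | exact ⟨_, rfl⟩

theorem exists_tail_inr {n : ℕ} (c : OCh (WedgeP T R) (wRel r) (n + 1)) (i : Fin n) :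
    ∃ x, c.1 i.succ = some (Sum.inr x) :=
  wRel_right_inr r (c.2 (Fin.succ_pos i))

/-- Every nonempty chain of the wedge starts at a point of `T`, at `0̂`, or lies in the disjoint
union of the `Rₜ`. -/
theorem wedge_chain_induction {n : ℕ} {p : ACh (WedgeP T R) (wRel r) (n + 1) → Prop}
    (h0 : p 0) (hadd : ∀ x y, p x → p y → p (x + y))
    (htip : ∀ t z, p (tipCone r t n z)) (hbase : ∀ z, p (sigCone r n z))
    (hincl : ∀ z, p (sigIncl r (n + 1) z)) (x : ACh (WedgeP T R) (wRel r) (n + 1)) : p x := by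
  induction x using Finsupp.induction_linear with
  | zero => exact h0
  | add x y hx hy => exact hadd x y hx hy
  | single c a =>
    choose s hs using exists_tail_inr r c
    rcases hc : c.1 0 with _ | (t | b)
    · have hrel : ∀ ⦃i j⦄, i < j → sigRel r (s i) (s j) := by
        intro i j hij
        have := c.2 (Fin.succ_lt_succ_iff.2 hij)
        rw [hs, hs] at this
        exact this
      obtain ⟨d, hd⟩ : ∃ d : OCh _ (sigRel r) n, ∀ i, d.1 i = s i := ⟨⟨s, hrel⟩, fun _ => rfl⟩
      have := hbase (Finsupp.single d a)
      rw [sigCone, coneL_single] at this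
      convert this using 1
      refine congrArg (Finsupp.single · a) (Subtype.ext (funext fun i => ?_))
      refine Fin.cases ?_ (fun i => ?_) i
      · simp [coneMap, hc]
      · simp [coneMap, hs, hd]
    · have hx : ∀ i : Fin n, ∃ x : R t, c.1 i.succ = some (Sum.inr ⟨t, x⟩) := by
        intro i
        have := c.2 (Fin.succ_pos i)
        rw [hc, hs] at this
        rw [hs]
        generalize s i = y at this
        obtain ⟨t', x⟩ := y
        obtain rfl : t = t' := this
        exact ⟨x, rfl⟩
      choose x hx using hx
      have hrel : ∀ ⦃i j⦄, i < j → r t (x i) (x j) := by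
        intro i j hij
        have := c.2 (Fin.succ_lt_succ_iff.2 hij)
        rw [hx, hx] at this
        obtain ⟨_, h⟩ := this
        exact h
      obtain ⟨d, hd⟩ : ∃ d : OCh _ (r t) n, ∀ i, d.1 i = x i := ⟨⟨x, hrel⟩, fun _ => rfl⟩
      have := htip t (Finsupp.single d a)
      rw [tipCone, coneL_single] at this
      convert this using 1
      refine congrArg (Finsupp.single · a) (Subtype.ext (funext fun i => ?_))
      refine Fin.cases ?_ (fun i => ?_) i
      · simp [coneMap, hc]
      · simp [coneMap, hx, hd]
    · have hx : ∀ i, ∃ x, c.1 i = some (Sum.inr x) := by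
        intro i
        refine Fin.cases ⟨b, hc⟩ (fun i => ⟨_, hs i⟩) i
      choose x hx using hx
      have hrel : ∀ ⦃i j⦄, i < j → sigRel r (x i) (x j) := by
        intro i j hij
        have := c.2 hij
        rw [hx, hx] at this
        exact this
      obtain ⟨d, hd⟩ : ∃ d : OCh _ (sigRel r) (n + 1), ∀ i, d.1 i = x i :=
        ⟨⟨x, hrel⟩, fun _ => rfl⟩
      have := hincl (Finsupp.single d a)
      rw [sigIncl, cmapL_single] at this
      convert this using 1
      refine congrArg (Finsupp.single · a) (Subtype.ext (funext fun i => ?_))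
      simp [cmap, hx, hd]

theorem tipPart_bdry (t : T) (n : ℕ) (x : ACh (WedgeP T R) (wRel r) (n + 2)) :
    tipPart r t n (bdry _ _ (n + 1) x) = -bdry _ _ n (tipPart r t (n + 1) x) := by
  classical
  induction x using wedge_chain_induction with
  | h0 => simp
  | hadd x y hx hy => simp only [map_add, hx, hy]; abel
  | htip t' z =>
    rw [bdry_tipCone, map_sub, tipPart_sigIncl, zero_sub]
    by_cases h : t' = t
    · subst h
      rw [tipPart_tipCone, tipPart_tipCone]
    · rw [tipPart_tipCone_of_ne r h, tipPart_tipCone_of_ne r h, map_zero]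
  | hbase z => rw [bdry_sigCone, map_sub, tipPart_sigIncl, tipPart_sigCone, tipPart_sigCone]; simp
  | hincl z => rw [bdry_sigIncl, tipPart_sigIncl, tipPart_sigIncl]; simp

/-- The chain `t * z - 0̂ * z` of the wedge. -/
noncomputable def suspCone (t : T) (n : ℕ) :
    ACh (R t) (r t) n →ₗ[ℤ] ACh (WedgeP T R) (wRel r) (n + 1) :=
  tipCone r t n - baseCone r t n

theorem bdry_suspCone (t : T) (n : ℕ) (z : ACh (R t) (r t) (n + 1)) :
    bdry _ (wRel r) (n + 1) (suspCone r t (n + 1) z) = -suspCone r t n (bdry _ _ n z) := by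
  simp only [suspCone, LinearMap.sub_apply, map_sub, ← sigCone_fibIncl, bdry_tipCone, bdry_sigCone,
    bdry_fibIncl]
  abel

theorem tipPart_suspCone (t : T) (n : ℕ) (z : ACh (R t) (r t) n) :
    tipPart r t n (suspCone r t n z) = z := by
  simp only [suspCone, LinearMap.sub_apply, map_sub, ← sigCone_fibIncl, tipPart_tipCone,
    tipPart_sigCone, sub_zero]

theorem tipPart_suspCone_of_ne {t t' : T} (h : t ≠ t') (n : ℕ) (z : ACh (R t) (r t) n) :
    tipPart r t' n (suspCone r t n z) = 0 := by
  simp only [suspCone, LinearMap.sub_apply, map_sub, ← sigCone_fibIncl,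
    tipPart_tipCone_of_ne r h, tipPart_sigCone, sub_zero]

/-- The chain homotopy between the identity of the chains of the wedge and the composite of
`tipPart` and `suspCone`. -/
theorem wedge_homotopy [Fintype T] (n : ℕ) (x : ACh (WedgeP T R) (wRel r) (n + 2)) :
    bdry _ _ (n + 2) (sigCone r (n + 2) (sigPart r (n + 2) x)) +
        sigCone r (n + 1) (sigPart r (n + 1) (bdry _ _ (n + 1) x)) =
      x - ∑ t, suspCone r t (n + 1) (tipPart r t (n + 1) x) := by
  classical
  induction x using wedge_chain_induction with
  | h0 => simp
  | hadd x y hx hy =>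
    simp only [map_add, Finset.sum_add_distrib]
    rw [add_sub_add_comm, ← hx, ← hy]
    abel
  | htip t z =>
    rw [sigPart_tipCone, bdry_tipCone, map_sub, sigPart_tipCone, sigPart_sigIncl,
      Finset.sum_eq_single t, tipPart_tipCone, sub_zero, sigCone_fibIncl, suspCone]
    · simp
    · intro t' _ h
      rw [tipPart_tipCone_of_ne r h.symm, map_zero]
    · simp
  | hbase z =>
    rw [sigPart_sigCone, map_zero, map_zero, bdry_sigCone, map_sub, sigPart_sigCone,
      sigPart_sigIncl]
    simp [tipPart_sigCone]
  | hincl z =>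
    rw [sigPart_sigIncl, bdry_sigIncl, sigPart_sigIncl, bdry_sigCone]
    simp [tipPart_sigIncl]

theorem suspCone_mem_cyc (t : T) (k : ℕ) (z) (hz : z ∈ cyc (R t) (r t) k) :
    suspCone r t (k + 1) z ∈ cyc _ (wRel r) (k + 1) := by
  rw [cyc, LinearMap.mem_ker] at *
  rw [bdry_suspCone, hz, map_zero, neg_zero]

theorem suspCone_mem_bdries (t : T) (k : ℕ) (z) (hz : z ∈ bdries (R t) (r t) k) :
    suspCone r t (k + 1) z ∈ bdries _ (wRel r) (k + 1) := by
  obtain ⟨w, rfl⟩ := hz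
  exact ⟨-suspCone r t (k + 2) w, by rw [map_neg, bdry_suspCone, neg_neg]⟩

theorem tipPart_mem_cyc (t : T) (k : ℕ) (z) (hz : z ∈ cyc _ (wRel r) (k + 1)) :
    tipPart r t (k + 1) z ∈ cyc (R t) (r t) k := by
  rw [cyc, LinearMap.mem_ker] at *
  rw [← neg_eq_zero, ← tipPart_bdry, hz, map_zero]

theorem tipPart_mem_bdries (t : T) (k : ℕ) (z) (hz : z ∈ bdries _ (wRel r) (k + 1)) :
    tipPart r t (k + 1) z ∈ bdries (R t) (r t) k := by
  obtain ⟨w, rfl⟩ := hz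
  exact ⟨-tipPart r t (k + 2) w, by rw [map_neg, tipPart_bdry]⟩

/-- The map `[z] ↦ [t * z - 0̂ * z]` on reduced homology. -/
noncomputable def suspH (t : T) (k : ℕ) :
    redH (R t) (r t) k →ₗ[ℤ] redH (WedgeP T R) (wRel r) (k + 1) :=
  redHMap (suspCone r t (k + 1)) (suspCone_mem_cyc r t k) (suspCone_mem_bdries r t k)

/-- The projection of the reduced homology of the wedge to that of `Rₜ`. -/
noncomputable def tipH (t : T) (k : ℕ) :
    redH (WedgeP T R) (wRel r) (k + 1) →ₗ[ℤ] redH (R t) (r t) k :=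
  redHMap (tipPart r t (k + 1)) (tipPart_mem_cyc r t k) (tipPart_mem_bdries r t k)

theorem tipH_suspH (t : T) (k : ℕ) (x : redH (R t) (r t) k) : tipH r t k (suspH r t k x) = x := by
  induction x using Submodule.Quotient.induction_on with
  | H z => exact congrArg Submodule.Quotient.mk (Subtype.ext (tipPart_suspCone r t _ z.1))

theorem tipH_suspH_of_ne {t t' : T} (h : t ≠ t') (k : ℕ) (x : redH (R t) (r t) k) :
    tipH r t' k (suspH r t k x) = 0 := by
  induction x using Submodule.Quotient.induction_on with
  | H z => exact congrArg Submodule.Quotient.mk (Subtype.ext (tipPart_suspCone_of_ne r h _ z.1))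

theorem sum_suspH_tipH [Fintype T] (k : ℕ) (x : redH (WedgeP T R) (wRel r) (k + 1)) :
    ∑ t, suspH r t k (tipH r t k x) = x := by
  induction x using Submodule.Quotient.induction_on with
  | H z =>
    have hsum : ∑ t, suspH r t k (tipH r t k (Submodule.Quotient.mk z)) =
        Submodule.Quotient.mk (∑ t, (⟨_, suspCone_mem_cyc r t k _
          (tipPart_mem_cyc r t k _ z.2)⟩ : cyc _ (wRel r) (k + 1))) :=
      (map_sum (Submodule.mkQ _) _ _).symm
    rw [hsum, eq_comm, redH_mk_eq_mk]
    refine ⟨sigCone r _ (sigPart r _ z.1), ?_⟩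
    have hz : bdry _ (wRel r) (k + 1) z.1 = 0 := z.2
    have := wedge_homotopy r k z.1
    rw [hz, map_zero, map_zero, add_zero] at this
    rw [this]
    simp

/-- The isomorphism from the sum of the reduced homology groups of the `Rₜ` to the reduced
homology of the wedge of their suspensions. -/
noncomputable def wedgeEquiv [Finite T] [DecidableEq T] (k : ℕ) :
    (⨁ t, redH (R t) (r t) k) ≃+ redH (WedgeP T R) (wRel r) (k + 1) :=
  AddEquiv.ofBijective (DirectSum.toAddMonoid fun t => (suspH r t k).toAddMonoidHom) (by
    constructor
    · have key : ∀ (t : T) (x : ⨁ t, redH (R t) (r t) k),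
          tipH r t k (DirectSum.toAddMonoid (fun t => (suspH r t k).toAddMonoidHom) x) = x t := by
        intro t x
        induction x using DirectSum.induction_on with
        | zero => simp
        | add x y hx hy => rw [map_add, map_add, hx, hy, DirectSum.add_apply]
        | of t' x =>
          rw [DirectSum.toAddMonoid_of]
          by_cases h : t' = t
          · subst h
            rw [DirectSum.of_eq_same]
            exact tipH_suspH r _ k x
          · rw [DirectSum.of_eq_of_ne _ _ _ (Ne.symm h)]
            exact tipH_suspH_of_ne r h k x
      intro x y hxy
      ext t
      rw [← key t x, hxy, key]
    · intro y
      cases nonempty_fintype T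
      refine ⟨∑ t, DirectSum.of (fun t => redH (R t) (r t) k) t (tipH r t k y), ?_⟩
      rw [map_sum]
      simp only [DirectSum.toAddMonoid_of]
      exact sum_suspH_tipH r k y)

theorem wedgeEquiv_of [Finite T] [DecidableEq T] (k : ℕ) (t : T) (x : redH (R t) (r t) k) :
    wedgeEquiv r k (DirectSum.of (fun t => redH (R t) (r t) k) t x) = suspH r t k x :=
  DirectSum.toAddMonoid_of _ _ _

end WedgeHomology

theorem directSum_toAddMonoid_of_comp_apply {ι : Type*} [DecidableEq ι] {A : ι → Type*}
    [∀ i, AddCommMonoid (A i)] (f : ∀ i, A i →+ A i) (x : ⨁ i, A i) (i : ι) :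
    DirectSum.toAddMonoid (fun i => (DirectSum.of A i).comp (f i)) x i = f i (x i) := by
  have : DirectSum.toAddMonoid (fun i => (DirectSum.of A i).comp (f i)) = DirectSum.map f :=
    DirectSum.addHom_ext fun i y => by simp
  rw [this, DirectSum.map_apply]

section Induced

variable {P : Type*} [PartialOrder P] {G : Type*} [Group G] [MulAction G P] {Q : Set P}
  (hsmul : ∀ (g : G) ⦃x y : P⦄, x < y → g • x < g • y)

/-- The map `H̃ₖ(P_{>m}) → H̃ₖ(P_{>m'})` given by an element `g` with `g • m = m'`. -/
noncomputable def transH (k : ℕ) (g : G) (m m' : ↥(Mset Q)) (h : g • (m : P) = m') :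
    redH (PgtT m) (rgt m) k →+ redH (PgtT m') (rgt m') k :=
  (indH (rα := rgt m) (rβ := rgt m')
    (fun x : PgtT m => (⟨g • (x : P), lt_of_le_of_lt (le_of_eq h.symm) (hsmul g x.2)⟩ : PgtT m'))
    (fun _ _ hab => hsmul g hab) k).toAddMonoidHom

theorem transH_transH (k : ℕ) (g g' g'' : G) (m m' m'' : ↥(Mset Q)) (h : g • (m : P) = m')
    (h' : g' • (m' : P) = m'') (h'' : g'' • (m : P) = m'') (hg : g' * g = g'')
    (x : redH (PgtT m) (rgt m) k) :
    transH hsmul k g' m' m'' h' (transH hsmul k g m m' h x) = transH hsmul k g'' m m'' h'' x := by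
  subst hg
  refine (indH_comp _ _ _ _ k x).trans (indH_congr ?_ k x)
  funext y
  exact Subtype.ext (smul_smul g' g (y : P))

theorem transH_one (k : ℕ) (m : ↥(Mset Q)) (h : (1 : G) • (m : P) = m)
    (x : redH (PgtT m) (rgt m) k) : transH hsmul k 1 m m h x = x := by
  refine (indH_congr ?_ k x).trans (indH_id k x)
  funext y
  exact Subtype.ext (one_smul G (y : P))

theorem transH_congr {k : ℕ} (x : ∀ m : ↥(Mset Q), redH (PgtT m) (rgt m) k) {g g' : G}
    {m m' m₀ : ↥(Mset Q)} (hg : g = g') (hm : m = m') (h : g • (m : P) = m₀)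
    (h' : g' • (m' : P) = m₀) :
    transH hsmul k g m m₀ h (x m) = transH hsmul k g' m' m₀ h' (x m') := by
  subst hg hm; rfl

variable (hQG : ∀ (g : G) (q : P), q ∈ Q → g • q ∈ Q)

theorem sumAct_of [DecidableEq P] (k : ℕ) (g : G) (m : ↥(Mset Q))
    (x : redH (PgtT m) (rgt m) k) :
    sumAct hsmul hQG k g (DirectSum.of (fun m : ↥(Mset Q) => redH (PgtT m) (rgt m) k) m x) =
      DirectSum.of (fun m : ↥(Mset Q) => redH (PgtT m) (rgt m) k) (gMe hQG g m)
        (transH hsmul k g m (gMe hQG g m) rfl x) :=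
  DirectSum.toAddMonoid_of _ _ _

theorem sumAct_apply [DecidableEq P] (k : ℕ) (g : G) (m m' : ↥(Mset Q)) (h : g • (m : P) = m')
    (x : ⨁ m : ↥(Mset Q), redH (PgtT m) (rgt m) k) :
    sumAct hsmul hQG k g x m' = transH hsmul k g m m' h (x m) := by
  obtain rfl : gMe hQG g m = m' := Subtype.ext h
  induction x using DirectSum.induction_on with
  | zero => simp
  | add x y hx hy => rw [map_add, DirectSum.add_apply, hx, hy, DirectSum.add_apply, map_add]
  | of m₁ x =>
    rw [sumAct_of]
    by_cases hm : m₁ = m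
    · subst hm
      rw [DirectSum.of_eq_same, DirectSum.of_eq_same]
    · rw [DirectSum.of_eq_of_ne _ _ _ (Ne.symm hm), map_zero, DirectSum.of_eq_of_ne]
      intro h'
      exact hm (Subtype.ext (MulAction.injective g (congrArg Subtype.val h')).symm)

/-- The map `x ↦ (γ ↦ γ⁻¹ • x_{γ m₀})` to the induced module at `m₀`. -/
noncomputable def toInd (k : ℕ) (m₀ : ↥(Mset Q)) :
    (⨁ m : ↥(Mset Q), redH (PgtT m) (rgt m) k) →+
      ↥(IndSubG (stabSet Q m₀) (stabρ hsmul m₀ k)) where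
  toFun x := ⟨fun γ => transH hsmul k γ⁻¹ (gMe hQG γ m₀) m₀ (inv_smul_smul γ (m₀ : P))
    (x (gMe hQG γ m₀)), by
      intro g h hh hh'
      have hm : gMe hQG (g * h) m₀ = gMe hQG g m₀ :=
        Subtype.ext ((mul_smul g h (m₀ : P)).trans (congrArg (g • ·) hh))
      have h1 : (g * h)⁻¹ • (gMe hQG g m₀ : P) = m₀ := by
        rw [← hm]; exact inv_smul_smul (g * h) (m₀ : P)
      refine (transH_congr hsmul (fun m => x m) rfl hm _ h1).trans ?_
      exact (transH_transH hsmul k g⁻¹ h⁻¹ (g * h)⁻¹ _ m₀ m₀ _ hh' _ (mul_inv_rev g h).symm _).symm⟩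
  map_zero' := by
    apply Subtype.ext
    funext γ
    simp
  map_add' x y := by
    apply Subtype.ext
    funext γ
    simp

theorem toInd_apply (k : ℕ) (m₀ m : ↥(Mset Q)) (γ : G) (h : γ⁻¹ • (m : P) = m₀)
    (x : ⨁ m : ↥(Mset Q), redH (PgtT m) (rgt m) k) :
    (toInd hsmul hQG k m₀ x).1 γ = transH hsmul k γ⁻¹ m m₀ h (x m) :=
  transH_congr hsmul (fun m => x m) rfl (Subtype.ext (by simp [gMe, ← h])) _ _

theorem toInd_sumAct [DecidableEq P] (k : ℕ) (m₀ : ↥(Mset Q)) (g : G)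
    (x : ⨁ m : ↥(Mset Q), redH (PgtT m) (rgt m) k) :
    toInd hsmul hQG k m₀ (sumAct hsmul hQG k g x) =
      indTrans (stabSet Q m₀) (stabρ hsmul m₀ k) g (toInd hsmul hQG k m₀ x) := by
  apply Subtype.ext
  funext γ
  have h1 : γ⁻¹ • (gMe hQG γ m₀ : P) = m₀ := inv_smul_smul γ (m₀ : P)
  have h2 : (g⁻¹ * γ)⁻¹ • (gMe hQG (g⁻¹ * γ) m₀ : P) = m₀ := inv_smul_smul (g⁻¹ * γ) (m₀ : P)
  have h3 : g • (gMe hQG (g⁻¹ * γ) m₀ : P) = gMe hQG γ m₀ := by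
    simp [gMe, mul_smul]
  change _ = (toInd hsmul hQG k m₀ x).1 (g⁻¹ * γ)
  rw [toInd_apply hsmul hQG k m₀ _ _ h1, toInd_apply hsmul hQG k m₀ _ _ h2,
    sumAct_apply hsmul hQG k g _ _ h3]
  exact transH_transH hsmul k _ _ _ _ _ _ _ _ _ (by group) _

variable (reps : Set ↥(Mset Q))

/-- The sum of the maps `toInd` over a finite set of elements of `M`. -/
noncomputable def toIndSum [Finite P] (k : ℕ) :
    (⨁ m : ↥(Mset Q), redH (PgtT m) (rgt m) k) →+
      ⨁ m₀ : ↥reps, ↥(IndSubG (stabSet Q m₀.1) (stabρ hsmul m₀.1 k)) :=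
  haveI := Fintype.ofFinite ↥reps
  (DirectSum.addEquivProd fun m₀ : ↥reps =>
      ↥(IndSubG (stabSet Q m₀.1) (stabρ hsmul m₀.1 k))).symm.toAddMonoidHom.comp
    (AddMonoidHom.pi fun m₀ : ↥reps => toInd hsmul hQG k m₀.1)

theorem toIndSum_apply [Finite P] (k : ℕ) (x : ⨁ m : ↥(Mset Q), redH (PgtT m) (rgt m) k)
    (m₀ : ↥reps) : toIndSum hsmul hQG reps k x m₀ = toInd hsmul hQG k m₀.1 x := rfl

theorem toIndSum_bijective [Finite P] [DecidableEq P]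
    (htrans : ∀ m : ↥(Mset Q),
      ∃! m₀ : ↥(Mset Q), m₀ ∈ reps ∧ ∃ g : G, g • (m : P) = (m₀ : P)) (k : ℕ) :
    Function.Bijective (toIndSum hsmul hQG reps k) := by
  constructor
  · intro x y hxy
    ext m
    obtain ⟨m₀, ⟨hm₀, g, hg⟩, -⟩ := htrans m
    have hg' : g⁻¹⁻¹ • (m : P) = m₀ := by rwa [inv_inv]
    have h0 : (toInd hsmul hQG k m₀ x).1 g⁻¹ = (toInd hsmul hQG k m₀ y).1 g⁻¹ := by
      rw [← toIndSum_apply hsmul hQG reps k x ⟨m₀, hm₀⟩, hxy]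
      rfl
    rw [toInd_apply hsmul hQG k m₀ m g⁻¹ hg', toInd_apply hsmul hQG k m₀ m g⁻¹ hg'] at h0
    have hinv : ∀ x : redH (PgtT m) (rgt m) k, transH hsmul k g⁻¹ m₀ m (by simp [← hg])
        (transH hsmul k g⁻¹⁻¹ m m₀ hg' x) = x := fun x =>
      (transH_transH hsmul k _ _ 1 _ _ _ _ _ (one_smul _ _) (by simp) x).trans
        (transH_one hsmul k m _ x)
    rw [← hinv (x m), h0, hinv]
  · intro y
    have hex : ∀ m : ↥(Mset Q), ∃ x : redH (PgtT m) (rgt m) k, ∀ (m₀ : ↥reps) (γ : G)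
        (h : γ • (m₀.1 : P) = m), x = transH hsmul k γ m₀.1 m h ((y m₀).1 γ) := by
      intro m
      obtain ⟨m₀, ⟨hm₀, g, hg⟩, huniq⟩ := htrans m
      have hg' : g⁻¹ • (m₀ : P) = m := by simp [← hg]
      refine ⟨transH hsmul k g⁻¹ m₀ m hg' ((y ⟨m₀, hm₀⟩).1 g⁻¹), ?_⟩
      rintro ⟨m₁, hm₁⟩ γ h
      obtain rfl : m₁ = m₀ := huniq m₁ ⟨hm₁, γ⁻¹, by simp [← h]⟩
      have hst : (g * γ) • (m₁ : P) = m₁ := by rw [mul_smul, h, hg]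
      have hst' : (g * γ)⁻¹ • (m₁ : P) = m₁ := inv_smul_eq_iff.2 hst.symm
      have hy := (y ⟨m₁, hm₁⟩).2 g⁻¹ (g * γ) hst hst'
      rw [inv_mul_cancel_left] at hy
      rw [hy]
      exact (transH_transH hsmul k _ γ _ _ _ _ hst' _ _ (by group) _).symm
    choose x hx using hex
    cases nonempty_fintype ↥(Mset Q)
    refine ⟨(DirectSum.addEquivProd fun m : ↥(Mset Q) => redH (PgtT m) (rgt m) k).symm x, ?_⟩
    ext m₀ : 1
    rw [toIndSum_apply]
    apply Subtype.ext
    funext γ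
    have h1 : γ • (m₀.1 : P) = gMe hQG γ m₀.1 := rfl
    have h2 : γ⁻¹ • (gMe hQG γ m₀.1 : P) = m₀.1 := inv_smul_smul γ (m₀.1 : P)
    rw [toInd_apply hsmul hQG k m₀.1 _ γ h2]
    change transH hsmul k γ⁻¹ _ _ h2 (x _) = _
    rw [hx _ m₀ γ h1, transH_transH hsmul k _ _ 1 _ _ _ _ _ (one_smul _ _) (by simp)]
    exact transH_one hsmul k _ _ _

end Induced

section Equivariance

variable {P : Type*} [PartialOrder P] {G : Type*} [Group G] [MulAction G P] {Q : Set P}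
  (hsmul : ∀ (g : G) ⦃x y : P⦄, x < y → g • x < g • y)
  (hQG : ∀ (g : G) (q : P), q ∈ Q → g • q ∈ Q)

variable (Q) in
/-- The isomorphism `wedgeEquiv` for the posets `P_{>m}`, `m ∈ M`. -/
noncomputable def gtWedgeEquiv [Finite P] [DecidableEq P] (k : ℕ) :
    (⨁ m : ↥(Mset Q), redH (PgtT m) (rgt m) k) ≃+ redH (WT P Q) (wrelT P Q) (k + 1) :=
  wedgeEquiv (fun m : ↥(Mset Q) => rgt m) k

theorem gtWedgeEquiv_of_mk [Finite P] [DecidableEq P] (k : ℕ) (m : ↥(Mset Q))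
    (z : cyc (PgtT m) (rgt m) k) (w : cyc (WT P Q) (wrelT P Q) (k + 1))
    (hw : (w : ACh (WT P Q) (wrelT P Q) (k + 2)) =
      suspCone (fun m : ↥(Mset Q) => rgt m) m (k + 1) z.1) :
    gtWedgeEquiv Q k (DirectSum.of (fun m : ↥(Mset Q) => redH (PgtT m) (rgt m) k) m
      (Submodule.Quotient.mk z)) = Submodule.Quotient.mk w := by
  refine (wedgeEquiv_of _ k m _).trans ?_
  exact congrArg Submodule.Quotient.mk (Subtype.ext hw.symm)

theorem cmapL_wVer_suspCone (n : ℕ) (g : G) (m : ↥(Mset Q)) (z : ACh (PgtT m) (rgt m) n) :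
    cmapL (rα := wrelT P Q) (rβ := wrelT P Q) (wVer hsmul hQG g) (wVer_mono hsmul hQG g) (n + 1)
        (suspCone (fun m : ↥(Mset Q) => rgt m) m n z) =
      suspCone (fun m : ↥(Mset Q) => rgt m) (gMe hQG g m) n
        (cmapL (rα := rgt m) (rβ := rgt (gMe hQG g m))
          (fun x : PgtT m => (⟨g • (x : P), hsmul g x.2⟩ : PgtT (gMe hQG g m)))
          (fun _ _ h => hsmul g h) n z) := by
  refine (map_sub (cmapL (rα := wrelT P Q) (rβ := wrelT P Q) (wVer hsmul hQG g)
    (wVer_mono hsmul hQG g) (n + 1)) (tipCone _ m n z) (baseCone _ m n z)).trans ?_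
  have htip := cmapL_coneL _ (wRel_inr_mk (r := fun m : ↥(Mset Q) => rgt m) m) _
    (wRel_inl_inr_mk _ m) (wVer hsmul hQG g) (wVer_mono hsmul hQG g)
    (fun x : PgtT m => (⟨g • (x : P), hsmul g x.2⟩ : PgtT (gMe hQG g m)))
    (fun _ _ h => hsmul g h) _ (wRel_inr_mk (r := fun m : ↥(Mset Q) => rgt m) (gMe hQG g m))
    (some (Sum.inl (gMe hQG g m))) (wRel_inl_inr_mk (fun m : ↥(Mset Q) => rgt m) _) rfl
    (fun _ => rfl) n z
  have hbase := cmapL_coneL _ (wRel_inr_mk (r := fun m : ↥(Mset Q) => rgt m) m) _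
    (fun x => wRel_none_inr _ ⟨m, x⟩) (wVer hsmul hQG g) (wVer_mono hsmul hQG g)
    (fun x : PgtT m => (⟨g • (x : P), hsmul g x.2⟩ : PgtT (gMe hQG g m)))
    (fun _ _ h => hsmul g h) _ (wRel_inr_mk (r := fun m : ↥(Mset Q) => rgt m) (gMe hQG g m))
    none (fun x => wRel_none_inr (fun m : ↥(Mset Q) => rgt m) ⟨_, x⟩) rfl (fun _ => rfl) n z
  exact congrArg₂ (fun a b : ACh (WT P Q) (wrelT P Q) (n + 1) => a - b) htip hbase

theorem gtWedgeEquiv_sumAct [Finite P] [DecidableEq P] (k : ℕ) (g : G)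
    (x : ⨁ m : ↥(Mset Q), redH (PgtT m) (rgt m) k) :
    gtWedgeEquiv Q k (sumAct hsmul hQG k g x) =
      indH (rα := wrelT P Q) (rβ := wrelT P Q) (wVer hsmul hQG g) (wVer_mono hsmul hQG g) (k + 1)
        (gtWedgeEquiv Q k x) := by
  induction x using DirectSum.induction_on with
  | zero => simp only [map_zero]
  | add x y hx hy => simp only [map_add, hx, hy]
  | of m x =>
    induction x using Submodule.Quotient.induction_on with
    | H z =>
      rw [sumAct_of, gtWedgeEquiv_of_mk k m z ⟨_, suspCone_mem_cyc _ m k _ z.2⟩ rfl]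
      exact gtWedgeEquiv_of_mk k (gMe hQG g m) _ ⟨_, cmapL_mem_cyc _ (wVer_mono hsmul hQG g)
        (suspCone_mem_cyc _ m k _ z.2)⟩ (cmapL_wVer_suspCone hsmul hQG (k + 1) g m z.1)

end Equivariance

/-- Segev–Webb, Proposition 2.3(ii).  If the finite `G`-poset `P` is an
extension of the `G`-stable subposet `Q` by minimal elements and `M = P \ Q`, then for
`n = k + 1 ≥ 1` the group `⊕_{m ∈ M} H̃ₙ₋₁(P_{>m})` is the induced `ℤG`-module
`⊕_{m ∈ [G\M]} Ind_{G_m}^G H̃ₙ₋₁(P_{>m})`, and the map `μ` of Proposition 2.2,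
`μ(Σₘ [zₘ]) = Σₘ [m * zₘ - 0̂ * zₘ]`, is an isomorphism of `ℤG`-modules onto
`H̃ₙ(⋁_{m ∈ M} Σ P_{>m})`. -/
theorem statement8 {P : Type*} [PartialOrder P] [Finite P] [DecidableEq P]
    {G : Type*} [Group G] [MulAction G P]
    (hsmul : ∀ (g : G) ⦃x y : P⦄, x < y → g • x < g • y)
    (Q : Set P)
    (hQupper : ∀ q ∈ Q, ∀ p : P, q ≤ p → p ∈ Q)
    (hQext : ∀ p : P, ∃ q ∈ Q, p ≤ q)
    (hQG : ∀ (g : G) (q : P), q ∈ Q → g • q ∈ Q)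
    (hmin : ∀ p : P, p ∈ Q ∨ ∀ x : P, ¬ x < p)
    (k : ℕ) (reps : Set ↥(Mset Q))
    (htrans : ∀ m : ↥(Mset Q),
      ∃! m₀ : ↥(Mset Q), m₀ ∈ reps ∧ ∃ g : G, g • (m : P) = (m₀ : P)) :
    -- (i) the induced-module structure on `⊕_{m ∈ M} H̃ₖ(P_{>m})`
    (∃ e : (⨁ m : ↥(Mset Q), redH (PgtT m) (rgt m) k) ≃+
        ⨁ m₀ : ↥reps, ↥(IndSubG (stabSet Q m₀.1) (stabρ hsmul m₀.1 k)),
      ∀ (g : G) (x : ⨁ m : ↥(Mset Q), redH (PgtT m) (rgt m) k),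
        e (sumAct hsmul hQG k g x) =
          DirectSum.toAddMonoid
            (fun m₀ : ↥reps =>
              (DirectSum.of
                  (fun m₀ : ↥reps => ↥(IndSubG (stabSet Q m₀.1) (stabρ hsmul m₀.1 k)))
                  m₀).comp
                (indTrans (stabSet Q m₀.1) (stabρ hsmul m₀.1 k) g))
            (e x)) ∧
    -- (ii) `μ` is an isomorphism of `ℤG`-modules
    (∃ μ : (⨁ m : ↥(Mset Q), redH (PgtT m) (rgt m) k) ≃+
        redH (WT P Q) (wrelT P Q) (k + 1),
      (∀ (m : ↥(Mset Q)) (z : ↥(cyc (PgtT m) (rgt m) k))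
        (w : ↥(cyc (WT P Q) (wrelT P Q) (k + 1))),
        (w : ACh (WT P Q) (wrelT P Q) (k + 2)) =
            coneL (rα := rgt m) (rβ := wrelT P Q)
              (fun x : PgtT m => (some (Sum.inr ⟨m, x⟩) : WT P Q))
              (fun _ _ h => ⟨rfl, h⟩) (some (Sum.inl m)) (fun _ => rfl) (k + 1)
              (z : ACh (PgtT m) (rgt m) (k + 1)) -
            coneL (rα := rgt m) (rβ := wrelT P Q)
              (fun x : PgtT m => (some (Sum.inr ⟨m, x⟩) : WT P Q))
              (fun _ _ h => ⟨rfl, h⟩) none (fun _ => trivial) (k + 1)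
              (z : ACh (PgtT m) (rgt m) (k + 1)) →
        μ (DirectSum.of (fun m : ↥(Mset Q) => redH (PgtT m) (rgt m) k) m
            (Submodule.Quotient.mk z)) = Submodule.Quotient.mk w) ∧
      (∀ (g : G) (x : ⨁ m : ↥(Mset Q), redH (PgtT m) (rgt m) k),
        μ (sumAct hsmul hQG k g x) =
          indH (rα := wrelT P Q) (rβ := wrelT P Q) (wVer hsmul hQG g)
            (wVer_mono hsmul hQG g) (k + 1) (μ x))) := by
  refine ⟨⟨AddEquiv.ofBijective (toIndSum hsmul hQG reps k)
    (toIndSum_bijective hsmul hQG reps htrans k), fun g x => ?_⟩,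
    gtWedgeEquiv Q k, fun m z w hw => gtWedgeEquiv_of_mk k m z w hw,
    gtWedgeEquiv_sumAct hsmul hQG k⟩
  · ext m₀ : 1
    refine (toInd_sumAct hsmul hQG k m₀.1 g x).trans ?_
    rw [← toIndSum_apply hsmul hQG reps k x m₀]
    exact (directSum_toAddMonoid_of_comp_apply
      (A := fun m₀ : ↥reps => ↥(IndSubG (stabSet Q m₀.1) (stabρ hsmul m₀.1 k)))
      (fun m₀ : ↥reps => indTrans (stabSet Q m₀.1) (stabρ hsmul m₀.1 k) g) _ m₀).symm
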